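/- arXiv:2102.05168 — 2 statements merged into one kernel-verified Lean document; each statement's English description precedes it below -/
import Mathlib

section
/- There is a universal constant C such that for every weighted graph G=(V,E,w) on n ≥ 2 vertices with all edge weights at least 1 and every root r ∈ V, there exists a well-separated (C·log²n)-approximate copy tree embedding of (G,r) with copy number at most C·log n. -/
/-- An edge set `F` connects vertices `u` and `v` if they lie in the same connected
component of the graph with edge set `F`. -/
def EdgeConn {V : Type*} (F : Set (Sym2 V)) (u v : V) : Prop :=
  (SimpleGraph.fromEdgeSet F).Reachable u v

/-- Vertex sets `U` and `W` are connected by the edge set `F` if some `u ∈ U` and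
some `w ∈ W` are connected by `F`. -/
def SetConn {V : Type*} (F : Set (Sym2 V)) (U W : Set V) : Prop :=
  ∃ u ∈ U, ∃ w ∈ W, EdgeConn F u w

/-- A rooted weighted tree is well-separated if every child edge has weight at most
half the weight of its parent edge.  Here the edge `{b,c}` is a child edge of `{a,b}`
when `b` is the endpoint of `{a,b}` farther from the root and `c` is farther still. -/
def WellSeparated {V : Type*} (T : SimpleGraph V) (root : V) (w : Sym2 V → ℝ) : Prop :=
  ∀ a b c : V, T.Adj a b → T.Adj b c →
    T.dist root b = T.dist root a + 1 → T.dist root c = T.dist root b + 1 →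
    w s(b, c) ≤ w s(a, b) / 2

/-- An `α`-approximate copy tree embedding of the weighted graph `(G, w)` with root `r`:
a weighted rooted tree together with a copy mapping and monotone edge-mapping functions
that preserve connectivity and `α`-approximately preserve cost. -/
structure CopyTreeEmbedding (V V' : Type*) (G : SimpleGraph V) (w : Sym2 V → ℝ)
    (r : V) (α : ℝ) where
  tree : SimpleGraph V'
  isTree : tree.IsTree
  w' : Sym2 V' → ℝ
  root : V'
  copies : V → Set V'
  copies_nonempty : ∀ v : V, (copies v).Nonempty
  copies_disjoint : ∀ u v : V, u ≠ v → Disjoint (copies u) (copies v)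
  copies_cover : ∀ v' : V', ∃ v : V, v' ∈ copies v
  copies_root : copies r = {root}
  mapGT : Finset (Sym2 V) → Finset (Sym2 V')
  mapTG : Finset (Sym2 V') → Finset (Sym2 V)
  mapGT_sub : ∀ F : Finset (Sym2 V), ↑F ⊆ G.edgeSet → ↑(mapGT F) ⊆ tree.edgeSet
  mapTG_sub : ∀ F' : Finset (Sym2 V'), ↑F' ⊆ tree.edgeSet → ↑(mapTG F') ⊆ G.edgeSet
  mapTG_mono : ∀ A B : Finset (Sym2 V'), A ⊆ B → mapTG A ⊆ mapTG B
  conn_GT : ∀ F : Finset (Sym2 V), ↑F ⊆ G.edgeSet → ∀ u v : V,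
      EdgeConn (↑F) u v → SetConn (↑(mapGT F)) (copies u) (copies v)
  conn_TG : ∀ F' : Finset (Sym2 V'), ↑F' ⊆ tree.edgeSet →
      ∀ (u v : V) (u' v' : V'), u' ∈ copies u → v' ∈ copies v →
      EdgeConn (↑F') u' v' → EdgeConn (↑(mapTG F')) u v
  cost_GT : ∀ F : Finset (Sym2 V), ↑F ⊆ G.edgeSet →
      ∑ e ∈ mapGT F, w' e ≤ α * ∑ e ∈ F, w e
  cost_TG : ∀ F' : Finset (Sym2 V'), ↑F' ⊆ tree.edgeSet →
      ∑ e ∈ mapTG F', w e ≤ ∑ e ∈ F', w' e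

namespace EdgeConn

variable {V : Type*} {F F' : Set (Sym2 V)} {u v x : V}

theorem refl (F : Set (Sym2 V)) (u : V) : EdgeConn F u u :=
  SimpleGraph.Reachable.refl u

theorem symm (h : EdgeConn F u v) : EdgeConn F v u :=
  SimpleGraph.Reachable.symm h

theorem trans (h : EdgeConn F u v) (h' : EdgeConn F v x) : EdgeConn F u x :=
  SimpleGraph.Reachable.trans h h'

theorem mono (hF : F ⊆ F') (h : EdgeConn F u v) : EdgeConn F' u v :=
  SimpleGraph.Reachable.mono (SimpleGraph.fromEdgeSet_mono hF) h

theorem of_mem (h : s(u, v) ∈ F) : EdgeConn F u v := by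
  by_cases huv : u = v
  · exact huv ▸ refl F u
  · exact SimpleGraph.Adj.reachable ((SimpleGraph.fromEdgeSet_adj F).2 ⟨h, huv⟩)

/-- Connectivity is the least equivalence relation relating the endpoints of every edge. -/
theorem induction {P : V → Prop} (h : EdgeConn F u v) (hu : P u)
    (step : ∀ a b, s(a, b) ∈ F → P a → P b) : P v := by
  obtain ⟨p⟩ := h
  induction p with
  | nil => exact hu
  | cons hab _ ih => exact ih (step _ _ ((SimpleGraph.fromEdgeSet_adj F).1 hab).1 hu)

/-- A map sending every edge of `F` to a connected pair preserves connectivity. -/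
theorem map {N : Type*} {E : Set (Sym2 N)} {f : V → N} (h : EdgeConn F u v)
    (hf : ∀ a b, s(a, b) ∈ F → EdgeConn E (f a) (f b)) : EdgeConn E (f u) (f v) :=
  h.induction (P := fun y => EdgeConn E (f u) (f y)) (refl E _)
    fun a b hab hua => hua.trans (hf a b hab)

end EdgeConn

/-- A finite union costs at most the sum of the costs of its members. -/
theorem sum_biUnion_le_sum_sum {ι β : Type*} [DecidableEq β] (s : Finset ι) (t : ι → Finset β)
    (w : β → ℝ) (hw : ∀ i ∈ s, ∀ e ∈ t i, 0 ≤ w e) :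
    ∑ e ∈ s.biUnion t, w e ≤ ∑ i ∈ s, ∑ e ∈ t i, w e := by
  classical
  induction s using Finset.induction_on with
  | empty => simp
  | insert a s ha ih =>
    rw [Finset.biUnion_insert, Finset.sum_insert ha]
    have h1 := Finset.sum_union_inter (s₁ := t a) (s₂ := s.biUnion t) (f := w)
    have h2 : 0 ≤ ∑ e ∈ t a ∩ s.biUnion t, w e := Finset.sum_nonneg fun e he =>
      hw a (Finset.mem_insert_self a s) e (Finset.mem_inter.1 he).1
    have h3 := ih fun i hi => hw i (Finset.mem_insert_of_mem hi)
    linarith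

/-- A pseudometric, as a bare real-valued function. -/
structure IsPseudometric {V : Type*} (d : V → V → ℝ) : Prop where
  self : ∀ x, d x x = 0
  symm : ∀ x y, d x y = d y x
  triangle : ∀ x y z, d x z ≤ d x y + d y z
  nonneg : ∀ x y, 0 ≤ d x y

/-- The metric of a connected weighted graph: `d u v` is the least cost of an edge set
connecting `u` and `v`, and it is attained. -/
theorem exists_graph_metric {V : Type*} [Fintype V] (G : SimpleGraph V) (w : Sym2 V → ℝ)
    (hG : G.Connected) (hw : ∀ e ∈ G.edgeSet, 1 ≤ w e) :
    ∃ d : V → V → ℝ, IsPseudometric d ∧ (∀ x y, x ≠ y → 1 ≤ d x y) ∧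
      (∀ x y, s(x, y) ∈ G.edgeSet → d x y ≤ w s(x, y)) ∧
      ∀ x y, ∃ S : Finset (Sym2 V), ↑S ⊆ G.edgeSet ∧ EdgeConn (↑S) x y ∧
        ∑ e ∈ S, w e = d x y := by
  classical
  have key : ∀ x y : V, ∃ S : Finset (Sym2 V), (↑S ⊆ G.edgeSet ∧ EdgeConn (↑S) x y) ∧
      ∀ S' : Finset (Sym2 V), ↑S' ⊆ G.edgeSet → EdgeConn (↑S') x y →
        ∑ e ∈ S, w e ≤ ∑ e ∈ S', w e := by
    intro x y
    have hne : (Finset.univ.filter fun S : Finset (Sym2 V) =>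
        ↑S ⊆ G.edgeSet ∧ EdgeConn (↑S) x y).Nonempty := by
      refine ⟨Finset.univ.filter (· ∈ G.edgeSet), ?_⟩
      simp only [Finset.mem_filter, Finset.mem_univ, true_and, Finset.coe_filter]
      refine ⟨fun e he => he, ?_⟩
      have := hG.preconnected x y
      simpa [EdgeConn, Set.ofPred_mem_eq] using this
    obtain ⟨S, hS, hmin⟩ := Finset.exists_min_image _ (fun S => ∑ e ∈ S, w e) hne
    simp only [Finset.mem_filter, Finset.mem_univ, true_and] at hS hmin
    exact ⟨S, hS, fun S' h1 h2 => hmin S' ⟨h1, h2⟩⟩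
  choose S hS hmin using key
  have w0 : ∀ S : Finset (Sym2 V), ↑S ⊆ G.edgeSet → ∀ e ∈ S, 0 ≤ w e := fun S hS e he =>
    zero_le_one.trans (hw e (hS he))
  refine ⟨fun x y => ∑ e ∈ S x y, w e, ⟨?_, ?_, ?_, ?_⟩, ?_, ?_, ?_⟩
  · intro x
    refine le_antisymm ?_ (Finset.sum_nonneg (w0 _ (hS x x).1))
    simpa using hmin x x ∅ (by simp) (EdgeConn.refl _ x)
  · intro x y
    exact le_antisymm (hmin x y _ (hS y x).1 (hS y x).2.symm)
      (hmin y x _ (hS x y).1 (hS x y).2.symm)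
  · intro x y z
    refine (hmin x z (S x y ∪ S y z) ?_ ?_).trans ?_
    · simpa using ⟨(hS x y).1, (hS y z).1⟩
    · exact ((hS x y).2.mono (by simp)).trans ((hS y z).2.mono (by simp))
    · have h1 := Finset.sum_union_inter (s₁ := S x y) (s₂ := S y z) (f := w)
      have h2 : 0 ≤ ∑ e ∈ S x y ∩ S y z, w e := Finset.sum_nonneg fun e he =>
        w0 _ (hS x y).1 e (Finset.mem_inter.1 he).1
      linarith
  · intro x y
    exact Finset.sum_nonneg (w0 _ (hS x y).1)
  · intro x y hxy
    have hne : (S x y).Nonempty := by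
      rw [Finset.nonempty_iff_ne_empty]
      intro h
      have hc := (hS x y).2
      rw [h] at hc
      exact hxy (hc.induction (P := fun z => x = z) rfl (by simp))
    obtain ⟨e, he⟩ := hne
    exact (hw e ((hS x y).1 he)).trans
      (Finset.single_le_sum (f := w) (w0 _ (hS x y).1) he)
  · intro x y hxy
    simpa using hmin x y {s(x, y)} (by simpa using hxy) (EdgeConn.of_mem (by simp))
  · exact fun x y => ⟨S x y, (hS x y).1, (hS x y).2, rfl⟩

/-- The length of a list of points with respect to `d`. -/
def tourLength {V : Type*} (d : V → V → ℝ) : List V → ℝ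
  | [] => 0
  | [_] => 0
  | a :: b :: l => d a b + tourLength d (b :: l)

theorem tourLength_insert {V : Type*} {d : V → V → ℝ} (hd : IsPseudometric d) (a b : V)
    (l₁ l₂ : List V) :
    tourLength d (l₁ ++ a :: b :: a :: l₂) = tourLength d (l₁ ++ a :: l₂) + 2 * d a b := by
  induction l₁ with
  | nil => simp only [List.nil_append, tourLength, hd.symm b a]; ring
  | cons x l ih =>
    cases l with
    | nil => simp only [List.nil_append, List.cons_append, tourLength, hd.symm b a]; ring
    | cons y l =>
      simp only [List.cons_append, tourLength] at ih ⊢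
      linarith

theorem tourLength_nonneg {V : Type*} {d : V → V → ℝ} (hd : IsPseudometric d) (l : List V) :
    0 ≤ tourLength d l := by
  induction l with
  | nil => simp [tourLength]
  | cons x l ih =>
    cases l with
    | nil => simp [tourLength]
    | cons y l => exact add_nonneg (hd.nonneg x y) ih

theorem tourLength_le_cons {V : Type*} {d : V → V → ℝ} (hd : IsPseudometric d) (x : V)
    (l : List V) : tourLength d l ≤ tourLength d (x :: l) := by
  cases l with
  | nil => simp [tourLength]
  | cons y l => exact le_add_of_nonneg_left (hd.nonneg x y)

theorem tourLength_cons_le_cons_cons {V : Type*} {d : V → V → ℝ} (hd : IsPseudometric d)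
    (x y : V) (l : List V) : tourLength d (x :: l) ≤ d x y + tourLength d (y :: l) := by
  cases l with
  | nil => simpa [tourLength] using hd.nonneg x y
  | cons z l =>
    simp only [tourLength]
    linarith [hd.triangle x y z]

/-- Dropping points from a tour does not make it longer. -/
theorem tourLength_le_of_sublist {V : Type*} {d : V → V → ℝ} (hd : IsPseudometric d)
    {l l' : List V} (h : l.Sublist l') :
    tourLength d l ≤ tourLength d l' ∧
      ∀ x, tourLength d (x :: l) ≤ tourLength d (x :: l') := by
  induction h with
  | slnil => simp
  | cons a _ ih =>
    exact ⟨ih.1.trans (tourLength_le_cons hd a _), fun x =>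
      (tourLength_cons_le_cons_cons hd x a _).trans (add_le_add_right (ih.2 a) _)⟩
  | cons_cons a _ ih => exact ⟨ih.2 a, fun x => add_le_add_right (ih.2 a) _⟩

/-- The component of `x` in `F` has a tour of length at most twice the cost of its edges. -/
theorem exists_tour {V : Type*} [Fintype V] {d : V → V → ℝ} (hd : IsPseudometric d)
    (F : Finset (Sym2 V)) (w : Sym2 V → ℝ) (hw : ∀ e ∈ F, 0 ≤ w e)
    (hdw : ∀ x y, s(x, y) ∈ F → d x y ≤ w s(x, y)) (x : V) :
    ∃ l : List V, (∀ y, EdgeConn (↑F) x y → y ∈ l) ∧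
      ∃ E : Finset (Sym2 V), E ⊆ F ∧ (∀ e ∈ E, ∀ y ∈ e, EdgeConn (↑F) x y) ∧
        tourLength d l ≤ 2 * ∑ e ∈ E, w e := by
  classical
  let good : Finset V → Prop := fun S => x ∈ S ∧ (∀ y ∈ S, EdgeConn (↑F) x y) ∧
    ∃ l : List V, (∀ y ∈ S, y ∈ l) ∧
      tourLength d l ≤ 2 * ∑ e ∈ F with ∀ y ∈ e, y ∈ S, w e
  have hne : (Finset.univ.filter good).Nonempty := by
    refine ⟨{x}, ?_⟩
    simp only [Finset.mem_filter, Finset.mem_univ, true_and, good]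
    refine ⟨by simp, by simpa using EdgeConn.refl _ x, [x], by simp, ?_⟩
    simp only [tourLength]
    exact mul_nonneg zero_le_two (Finset.sum_nonneg fun e he => hw e (Finset.mem_filter.1 he).1)
  obtain ⟨S, hS, hmax⟩ := Finset.exists_max_image _ Finset.card hne
  simp only [Finset.mem_filter, Finset.mem_univ, true_and] at hS hmax
  obtain ⟨hxS, hconn, l, hl, hlen⟩ := hS
  have hclosed : ∀ a b, s(a, b) ∈ (F : Set (Sym2 V)) → a ∈ S → b ∈ S := by
    intro a b hab ha
    by_contra hb
    obtain ⟨l₁, l₂, rfl⟩ := List.append_of_mem (hl a ha)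
    have hg : good (insert b S) := by
      refine ⟨Finset.mem_insert_of_mem hxS, ?_, l₁ ++ a :: b :: a :: l₂, ?_, ?_⟩
      · intro y hy
        rcases Finset.mem_insert.1 hy with rfl | hy
        · exact (hconn a ha).trans (EdgeConn.of_mem hab)
        · exact hconn y hy
      · intro y hy
        rcases Finset.mem_insert.1 hy with rfl | hy
        · simp
        · have := hl y hy
          simp only [List.mem_append, List.mem_cons] at this ⊢
          tauto
      · rw [tourLength_insert hd]
        have hnot : s(a, b) ∉ F.filter fun e => ∀ y ∈ e, y ∈ S := by
          simp [hb]
        have hsub : insert s(a, b) (F.filter fun e => ∀ y ∈ e, y ∈ S) ⊆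
            F.filter fun e => ∀ y ∈ e, y ∈ insert b S := by
          intro e he
          rcases Finset.mem_insert.1 he with rfl | he
          · simp only [Finset.mem_filter]
            refine ⟨hab, ?_⟩
            simp [ha]
          · simp only [Finset.mem_filter] at he ⊢
            exact ⟨he.1, fun y hy => Finset.mem_insert_of_mem (he.2 y hy)⟩
        have h1 := Finset.sum_le_sum_of_subset_of_nonneg (f := w) hsub
          fun e he _ => hw e (Finset.mem_filter.1 he).1
        rw [Finset.sum_insert hnot] at h1
        linarith [hdw a b hab]
    have := hmax _ hg
    rw [Finset.card_insert_of_notMem hb] at this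
    omega
  refine ⟨l, fun y hy => hl y (hy.induction hxS hclosed),
    F.filter fun e => ∀ y ∈ e, y ∈ S, Finset.filter_subset _ _, ?_, hlen⟩
  intro e he y hy
  exact hconn y ((Finset.mem_filter.1 he).2 y hy)

/-- An `ℕ`-valued (pseudo-)ultrametric. -/
structure IsNatUltrametric {V : Type*} (D : V → V → ℕ) : Prop where
  self : ∀ x, D x x = 0
  symm : ∀ x y, D x y = D y x
  triangle : ∀ x y z, D x z ≤ max (D x y) (D y z)

/-- Ball growing: every point set of diameter less than `2 ^ ℓ` has a subset of large measure on
which `d` is approximated within a factor `8 * L` by `2 ^ D` for an ultrametric `D`. -/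
theorem exists_large_ultrametric_subset {V : Type*} [DecidableEq V] {d : V → V → ℝ}
    (hd : IsPseudometric d) (hsep : ∀ x y, x ≠ y → 1 ≤ d x y) (μ : V → ℝ) (L : ℕ) (hL : 0 < L)
    (ℓ : ℕ) : ∀ (X : Finset V) (m : ℝ), (∀ x ∈ X, 1 ≤ μ x) →
      (∀ x ∈ X, ∀ y ∈ X, d x y < 2 ^ ℓ) →
      (∀ x ∈ X, ∑ y ∈ X with d x y < 2 ^ ℓ / 4, μ y ≤ m) → 1 ≤ m →
      ∃ U ⊆ X, ∃ D : V → V → ℕ, IsNatUltrametric D ∧ (∀ u v, D u v ≤ ℓ) ∧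
        (∀ u ∈ U, ∀ v ∈ U, d u v ≤ 2 ^ D u v) ∧
        (∀ u ∈ U, ∀ v ∈ U, u ≠ v → (2 : ℝ) ^ D u v ≤ 8 * L * d u v) ∧
        ∑ x ∈ X, μ x - ∑ x ∈ U, μ x ≤ (∑ x ∈ X, μ x) * Real.log m / L := by
  have hL' : (0 : ℝ) < L := by exact_mod_cast hL
  induction ℓ with
  | zero =>
    intro X m hμ hdiam _ hm
    have hsub : ∀ x ∈ X, ∀ y ∈ X, x = y := by
      intro x hx y hy
      by_contra hne
      have h1 := hdiam x hx y hy
      have h2 := hsep x y hne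
      norm_num at h1
      linarith
    refine ⟨X, subset_rfl, fun _ _ => 0, ⟨by simp, by simp, by simp⟩, by simp, ?_, ?_, ?_⟩
    · intro u hu v hv
      rw [hsub u hu v hv, hd.self]
      positivity
    · intro u hu v hv huv
      exact absurd (hsub u hu v hv) huv
    · have h0 : 0 ≤ ∑ x ∈ X, μ x := Finset.sum_nonneg fun x hx => zero_le_one.trans (hμ x hx)
      have := Real.log_nonneg hm
      rw [sub_self]
      positivity
  | succ ℓ ihℓ =>
    intro X
    induction X using Finset.strongInduction with
    | H X ihX =>
    intro m hμ hdiam hball hm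
    rcases X.eq_empty_or_nonempty with rfl | hX
    · exact ⟨∅, subset_rfl, fun _ _ => 0, ⟨by simp, by simp, by simp⟩, by simp, by simp, by simp,
        by simp⟩
    have hμ0 : ∀ x ∈ X, 0 ≤ μ x := fun x hx => zero_le_one.trans (hμ x hx)
    obtain ⟨x, hx, hxmax⟩ := Finset.exists_max_image X
      (fun x => ∑ y ∈ X with d x y < 2 ^ ℓ / 4, μ y) hX
    set δ : ℝ := 2 ^ ℓ / 4 / L with hδ
    have hδL : δ * L = 2 ^ ℓ / 4 := by rw [hδ]; field_simp
    have hδ0 : 0 < δ := by positivity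
    let A : ℕ → Finset V := fun i => X.filter fun y => d x y < 2 ^ ℓ / 4 + i * δ
    have hAX : ∀ i, A i ⊆ X := fun i => Finset.filter_subset _ _
    have hxA : ∀ i, x ∈ A i := by
      intro i
      simp only [A, Finset.mem_filter, hd.self]
      exact ⟨hx, by positivity⟩
    have hAmono : ∀ i, A i ⊆ A (i + 1) := by
      intro i y hy
      simp only [A, Finset.mem_filter] at hy ⊢
      refine ⟨hy.1, hy.2.trans ?_⟩
      push_cast
      linarith
    let a : ℕ → ℝ := fun i => ∑ y ∈ A i, μ y
    have ha1 : ∀ i, 1 ≤ a i := fun i => (hμ x hx).trans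
      (Finset.single_le_sum (f := μ) (fun y hy => hμ0 y (hAX i hy)) (hxA i))
    have ha0 : a 0 = ∑ y ∈ X with d x y < 2 ^ ℓ / 4, μ y := by simp [a, A]
    have haL : a L ≤ m := by
      have h4 : (2 : ℝ) ^ ℓ / 4 + L * δ = 2 ^ (ℓ + 1) / 4 := by
        rw [mul_comm, hδL, pow_succ]; ring
      have := hball x hx
      simpa only [a, A, h4] using this
    obtain ⟨i, hi, hlog⟩ : ∃ i < L, Real.log (a (i + 1)) - Real.log (a i) ≤
        (Real.log m - Real.log (a 0)) / L := by
      by_contra! hcon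
      have h1 : ∑ i ∈ Finset.range L, (Real.log m - Real.log (a 0)) / L <
          ∑ i ∈ Finset.range L, (Real.log (a (i + 1)) - Real.log (a i)) :=
        Finset.sum_lt_sum_of_nonempty (by simpa using hL.ne') fun i hi =>
          hcon i (Finset.mem_range.1 hi)
      rw [Finset.sum_range_sub (fun i => Real.log (a i)), Finset.sum_const, Finset.card_range,
        nsmul_eq_mul, mul_div_cancel₀ _ hL'.ne'] at h1
      have h2 := Real.log_le_log (by linarith [ha1 L]) haL
      linarith
    have hshell : a (i + 1) - a i ≤ a (i + 1) * ((Real.log m - Real.log (a 0)) / L) := by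
      have p0 : 0 < a i := by linarith [ha1 i]
      have p1 : 0 < a (i + 1) := by linarith [ha1 (i + 1)]
      have h1 := Real.one_sub_inv_le_log_of_pos (div_pos p1 p0)
      rw [Real.log_div p1.ne' p0.ne', inv_div] at h1
      have h2 := mul_le_mul_of_nonneg_left (h1.trans hlog) p1.le
      have h3 : a (i + 1) * (1 - a i / a (i + 1)) = a (i + 1) - a i := by field_simp
      linarith
    obtain ⟨U₁, hU₁, D₁, hD₁, hℓ₁, hle₁, hge₁, hloss₁⟩ := ihℓ (A i) (a 0)
      (fun y hy => hμ y (hAX i hy))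
      (by
        intro y hy z hz
        simp only [A, Finset.mem_filter] at hy hz
        have h1 := hd.triangle y x z
        rw [hd.symm y x] at h1
        have h2 : (i : ℝ) * δ ≤ 2 ^ ℓ / 4 := by
          rw [← hδL, mul_comm]
          exact mul_le_mul_of_nonneg_left (by exact_mod_cast hi.le) hδ0.le
        linarith [hy.2, hz.2])
      (by
        intro y hy
        refine le_trans ?_ ((hxmax y (hAX i hy)).trans ha0.ge)
        refine Finset.sum_le_sum_of_subset_of_nonneg
          (Finset.filter_subset_filter _ (hAX i)) fun z hz _ => hμ0 z (Finset.mem_filter.1 hz).1)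
      (ha1 0)
    have hBX : X \ A (i + 1) ⊆ X := Finset.sdiff_subset
    obtain ⟨U₂, hU₂, D₂, hD₂, hℓ₂, hle₂, hge₂, hloss₂⟩ := ihX (X \ A (i + 1))
      (Finset.sdiff_ssubset (hAX _) ⟨x, hxA _⟩) m
      (fun y hy => hμ y (hBX hy)) (fun y hy z hz => hdiam y (hBX hy) z (hBX hz))
      (by
        intro y hy
        refine le_trans ?_ (hball y (hBX hy))
        exact Finset.sum_le_sum_of_subset_of_nonneg
          (Finset.filter_subset_filter _ hBX) fun z hz _ => hμ0 z (Finset.mem_filter.1 hz).1)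
      hm
    have hdisj : Disjoint U₁ U₂ := by
      rw [Finset.disjoint_left]
      intro y h1 h2
      exact (Finset.mem_sdiff.1 (hU₂ h2)).2 (hAmono i (hU₁ h1))
    have hfar : ∀ u ∈ U₁, ∀ v ∈ U₂, d u v ≤ 2 ^ (ℓ + 1) ∧
        (2 : ℝ) ^ (ℓ + 1) ≤ 8 * L * d u v := by
      intro u hu v hv
      have hu' := hU₁ hu
      have hv' := Finset.mem_sdiff.1 (hU₂ hv)
      refine ⟨(hdiam u (hAX _ hu') v hv'.1).le, ?_⟩
      have h1 := (Finset.mem_filter.1 hu').2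
      have h2 : 2 ^ ℓ / 4 + ((i + 1 : ℕ) : ℝ) * δ ≤ d x v := by
        by_contra! h
        exact hv'.2 (Finset.mem_filter.2 ⟨hv'.1, h⟩)
      push_cast at h2
      have h3 : δ ≤ d u v := by linarith [hd.triangle x u v]
      have h4 := mul_le_mul_of_nonneg_left h3 hL'.le
      rw [pow_succ]
      nlinarith
    refine ⟨U₁ ∪ U₂, Finset.union_subset (hU₁.trans (hAX i)) (hU₂.trans hBX),
      fun u v => if u ∈ U₁ then (if v ∈ U₁ then D₁ u v else ℓ + 1) else
        if v ∈ U₁ then ℓ + 1 else D₂ u v, ⟨?_, ?_, ?_⟩, ?_, ?_, ?_, ?_⟩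
    · intro u
      simp only [hD₁.self, hD₂.self]
      split_ifs <;> rfl
    · intro u v
      simp only [hD₁.symm u v, hD₂.symm u v]
      split_ifs <;> rfl
    · intro u v z
      have h1 := hD₁.triangle u v z
      have h2 := hD₂.triangle u v z
      have h3 := hℓ₁ u z
      have h4 := hℓ₂ u z
      split_ifs <;> omega
    · intro u v
      have h3 := hℓ₁ u v
      have h4 := hℓ₂ u v
      beta_reduce
      split_ifs <;> omega
    · intro u hu v hv
      rw [Finset.mem_union] at hu hv
      beta_reduce
      split_ifs with h1 h2 h2
      · exact hle₁ u h1 v h2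
      · exact (hfar u h1 v (hv.resolve_left h2)).1
      · rw [hd.symm]
        exact (hfar v h2 u (hu.resolve_left h1)).1
      · exact hle₂ u (hu.resolve_left h1) v (hv.resolve_left h2)
    · intro u hu v hv huv
      rw [Finset.mem_union] at hu hv
      beta_reduce
      split_ifs with h1 h2 h2
      · exact hge₁ u h1 v h2 huv
      · exact (hfar u h1 v (hv.resolve_left h2)).2
      · rw [hd.symm]
        exact (hfar v h2 u (hu.resolve_left h1)).2
      · exact hge₂ u (hu.resolve_left h1) v (hv.resolve_left h2) huv
    · rw [Finset.sum_union hdisj]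
      have hsum : ∑ y ∈ X \ A (i + 1), μ y + a (i + 1) = ∑ y ∈ X, μ y :=
        Finset.sum_sdiff (hAX (i + 1))
      set b := ∑ y ∈ X \ A (i + 1), μ y
      have hle : a i ≤ a (i + 1) := Finset.sum_le_sum_of_subset_of_nonneg (hAmono i)
        fun y hy _ => hμ0 y (hAX _ hy)
      have hlog0 := Real.log_nonneg (ha1 0)
      change a i - _ ≤ a i * _ / _ at hloss₁
      rw [← hsum]
      have h5 : a i * Real.log (a 0) / L ≤ a (i + 1) * Real.log (a 0) / L := by gcongr
      have h6 : (b + a (i + 1)) * Real.log m / L = b * Real.log m / L +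
          a (i + 1) * ((Real.log m - Real.log (a 0)) / L) +
          a (i + 1) * Real.log (a 0) / L := by ring
      linarith

/-- For any set of pairs, some ultrametric approximates `d` on a set containing both ends of at
least half of the pairs. -/
theorem exists_ultrametric_half_pairs {V : Type*} [Fintype V] [DecidableEq V] {d : V → V → ℝ}
    (hd : IsPseudometric d) (hsep : ∀ x y, x ≠ y → 1 ≤ d x y) (L : ℕ) (hL : 0 < L)
    (hV : 0 < Fintype.card V) (hL4 : 4 * Real.log (2 * (Fintype.card V : ℝ) ^ 2) ≤ L)
    (P : Finset (V × V)) :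
    ∃ (D : V → V → ℕ) (U : Finset V), IsNatUltrametric D ∧ (∀ u v, d u v ≤ 2 ^ D u v) ∧
      (∀ u ∈ U, ∀ v ∈ U, u ≠ v → (2 : ℝ) ^ D u v ≤ 8 * L * d u v) ∧
      2 * (P.filter fun p => ¬(p.1 ∈ U ∧ p.2 ∈ U)).card ≤ P.card := by
  let μ : V → ℕ := fun v => (P.filter fun p => p.1 = v).card + (P.filter fun p => p.2 = v).card
  have hμsum : ∀ T : Finset V, ∑ v ∈ T, μ v =
      (P.filter fun p => p.1 ∈ T).card + (P.filter fun p => p.2 ∈ T).card := by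
    intro T
    rw [Finset.sum_add_distrib, Finset.sum_card_fiberwise_eq_card_filter,
      Finset.sum_card_fiberwise_eq_card_filter]
  have htot : ∑ v, μ v = 2 * P.card := by
    rw [hμsum]
    simp only [Finset.mem_univ, Finset.filter_true]
    ring
  have hPcard : P.card ≤ Fintype.card V ^ 2 := by
    have := P.card_le_univ
    rwa [Fintype.card_prod, ← sq] at this
  set X : Finset V := Finset.univ.filter fun v => 1 ≤ μ v with hX
  have hXtot : ∑ v ∈ X, μ v = 2 * P.card := by
    rw [← htot, hX]
    refine Finset.sum_filter_of_ne fun v _ hv => Nat.one_le_iff_ne_zero.2 hv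
  obtain ⟨ℓ, hℓ⟩ : ∃ ℓ : ℕ, ∀ x y, d x y < 2 ^ ℓ := by
    obtain ⟨B, hB⟩ := (Set.finite_range fun p : V × V => d p.1 p.2).bddAbove
    obtain ⟨ℓ, hℓ⟩ := pow_unbounded_of_one_lt B (one_lt_two : (1 : ℝ) < 2)
    exact ⟨ℓ, fun x y => (hB ⟨(x, y), rfl⟩).trans_lt hℓ⟩
  have hm : (1 : ℝ) ≤ 2 * (Fintype.card V : ℝ) ^ 2 := by
    have : (1 : ℝ) ≤ Fintype.card V := by exact_mod_cast hV
    nlinarith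
  obtain ⟨U, hUX, D, hD, hDℓ, hle, hge, hloss⟩ := exists_large_ultrametric_subset hd hsep
    (fun v => (μ v : ℝ)) L hL ℓ X (2 * (Fintype.card V : ℝ) ^ 2)
    (fun x hx => by exact_mod_cast (Finset.mem_filter.1 hx).2)
    (fun x _ y _ => hℓ x y)
    (fun x _ => by
      refine (Finset.sum_le_sum_of_subset_of_nonneg (Finset.filter_subset _ X)
        fun _ _ _ => Nat.cast_nonneg _).trans ?_
      have h : ∑ v ∈ X, μ v ≤ 2 * Fintype.card V ^ 2 := by omega
      exact_mod_cast h) hm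
  refine ⟨fun u v => if u = v then 0 else if u ∈ U ∧ v ∈ U then D u v else ℓ, U,
    ⟨?_, ?_, ?_⟩, ?_, ?_, ?_⟩
  · simp
  · intro u v
    simp only [hD.symm u v, eq_comm (a := u), and_comm (a := u ∈ U)]
  · intro u v z
    have h1 := hD.triangle u v z
    have h2 := hDℓ u z
    have h3 := hDℓ u v
    have h4 := hDℓ v z
    by_cases huv : u = v
    · subst huv; simp
    by_cases hvz : v = z
    · subst hvz; simp
    by_cases hu : u ∈ U <;> by_cases hv : v ∈ U <;> by_cases hz : z ∈ U <;>
      simp only [huv, hvz, hu, hv, hz, and_self, and_true, and_false, if_true,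
        if_false] <;> split_ifs <;> omega
  · intro u v
    beta_reduce
    split_ifs with h1 h2
    · rw [h1, hd.self]; positivity
    · exact hle u h2.1 v h2.2
    · exact (hℓ u v).le
  · intro u hu v hv huv
    simpa [huv, hu, hv] using hge u hu v hv huv
  · have hc := Finset.sum_add_sum_compl U μ
    rw [htot, hμsum Uᶜ] at hc
    have hsub : (P.filter fun p => ¬(p.1 ∈ U ∧ p.2 ∈ U)) ⊆
        (P.filter fun p => p.1 ∈ Uᶜ) ∪ P.filter fun p => p.2 ∈ Uᶜ := by
      intro p
      simp only [Finset.mem_filter, Finset.mem_union, Finset.mem_compl]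
      tauto
    have hcard := (Finset.card_le_card hsub).trans (Finset.card_union_le _ _)
    have hXtot' : ∑ v ∈ X, (μ v : ℝ) = 2 * P.card := by exact_mod_cast hXtot
    rw [hXtot'] at hloss
    have hloss' : 2 * (P.card : ℝ) - ∑ v ∈ U, (μ v : ℝ) ≤ P.card / 2 := by
      refine hloss.trans ?_
      have hL' : (0 : ℝ) < L := by exact_mod_cast hL
      rw [div_le_iff₀ hL']
      have := mul_le_mul_of_nonneg_left hL4 (Nat.cast_nonneg (α := ℝ) P.card)
      linarith
    have hloss'' : 3 * P.card ≤ 2 * ∑ v ∈ U, μ v := by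
      have : (3 : ℝ) * P.card ≤ 2 * ∑ v ∈ U, (μ v : ℝ) := by linarith
      exact_mod_cast this
    omega

/-- Greedy covering: if every finite set can be half covered by one element of `α`, then a set of
fewer than `2 ^ k` points can be covered by `k` elements. -/
theorem exists_cover_of_half_cover {α β : Type*} (good : α → β → Prop)
    [∀ a, DecidablePred (good a)]
    (h : ∀ P : Finset β, ∃ a, 2 * (P.filter fun p => ¬good a p).card ≤ P.card) (k : ℕ) :
    ∀ P : Finset β, P.card < 2 ^ k → ∃ f : ℕ → α, ∀ p ∈ P, ∃ i < k, good (f i) p := by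
  induction k with
  | zero =>
    intro P hP
    have : P = ∅ := by simpa using hP
    exact (h ∅).elim fun a _ => ⟨fun _ => a, by simp [this]⟩
  | succ k ih =>
    intro P hP
    obtain ⟨a, ha⟩ := h P
    obtain ⟨f, hf⟩ := ih (P.filter fun p => ¬good a p) (by rw [pow_succ] at hP; omega)
    refine ⟨fun i => Nat.casesOn i a f, fun p hp => ?_⟩
    by_cases hg : good a p
    · exact ⟨0, Nat.succ_pos k, hg⟩
    · obtain ⟨i, hi, hgi⟩ := hf p (Finset.mem_filter.2 ⟨hp, hg⟩)
      exact ⟨i + 1, Nat.succ_lt_succ hi, hgi⟩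

/-- The representative tree of an ultrametric `D` on points ranked by `e`: `lev v` is the least
radius at which `v` is not the first point of its ball, and `p v` is the first point of that
ball. -/
structure IsRepresentativeTree {V : Type*} (r : V) (e : V → ℕ) (D : V → V → ℕ) (p : V → V)
    (lev : V → ℕ) : Prop where
  rank_lt : ∀ v, v ≠ r → e (p v) < e v
  dist_le : ∀ v, v ≠ r → D (p v) v ≤ lev v
  rank_le : ∀ v, v ≠ r → ∀ u, D u v ≤ lev v → e (p v) ≤ e u
  lev_le : ∀ v, v ≠ r → ∀ u j, D u v ≤ j → e u < e v → lev v ≤ j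

theorem exists_representativeTree {V : Type*} (r : V) (e : V → ℕ) (he : Function.Injective e)
    (hr : e r = 0) (D : V → V → ℕ) :
    ∃ (p : V → V) (lev : V → ℕ), IsRepresentativeTree r e D p lev := by
  classical
  have key : ∀ v : V, ∃ (q : V) (l : ℕ), v ≠ r → e q < e v ∧ D q v ≤ l ∧
      (∀ u, D u v ≤ l → e q ≤ e u) ∧ ∀ u j, D u v ≤ j → e u < e v → l ≤ j := by
    intro v
    by_cases hv : v = r
    · exact ⟨v, 0, fun h => absurd hv h⟩
    have hev : e r < e v := by
      rw [hr]
      exact Nat.pos_of_ne_zero fun h => hv (he (h.trans hr.symm))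
    have h1 : ∃ j, ∃ u, D u v ≤ j ∧ e u < e v := ⟨_, r, le_rfl, hev⟩
    obtain ⟨u₀, hu₀, hu₀'⟩ := Nat.find_spec h1
    have h2 : ∃ t, ∃ u, D u v ≤ Nat.find h1 ∧ e u = t := ⟨_, u₀, hu₀, rfl⟩
    obtain ⟨q, hq, hqt⟩ := Nat.find_spec h2
    have hmin : ∀ u, D u v ≤ Nat.find h1 → e q ≤ e u := fun u hu =>
      hqt.le.trans (Nat.find_min' h2 ⟨u, hu, rfl⟩)
    exact ⟨q, Nat.find h1, fun _ => ⟨(hmin u₀ hu₀).trans_lt hu₀', hq, hmin,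
      fun u j hu hlt => Nat.find_min' h1 ⟨u, hu, hlt⟩⟩⟩
  choose p lev h using key
  exact ⟨p, lev, fun v hv => (h v hv).1, fun v hv => (h v hv).2.1,
    fun v hv => (h v hv).2.2.1, fun v hv => (h v hv).2.2.2⟩

namespace IsRepresentativeTree

variable {V : Type*} {r : V} {e : V → ℕ} {D : V → V → ℕ} {p : V → V} {lev : V → ℕ}

theorem lev_lt (h : IsRepresentativeTree r e D p lev) (hD : IsNatUltrametric D) {v : V}
    (hv : v ≠ r) (hpv : p v ≠ r) : lev v < lev (p v) := by
  by_contra! hle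
  have h1 := h.rank_le v hv (p (p v)) (by
    have h1 := hD.triangle (p (p v)) (p v) v
    have h2 := h.dist_le v hv
    have h3 := h.dist_le (p v) hpv
    omega)
  have h2 := h.rank_lt (p v) hpv
  omega

variable {N : Type*} {T : SimpleGraph N} {w' : Sym2 N → ℝ} {f : V → N}

/-- Climbing from `v` to the first point of its ball of radius `j`. -/
theorem exists_climb (h : IsRepresentativeTree r e D p lev) (hD : IsNatUltrametric D)
    (hr : e r = 0) (hw' : ∀ e ∈ T.edgeSet, 0 ≤ w' e)
    (hf : ∀ v, v ≠ r → s(f v, f (p v)) ∈ T.edgeSet ∧ w' s(f v, f (p v)) = 2 ^ lev v)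
    (j : ℕ) (v : V) :
    ∃ (S : Finset (Sym2 N)) (m : V), ↑S ⊆ T.edgeSet ∧ EdgeConn (↑S) (f v) (f m) ∧
      D m v ≤ j ∧ (∀ u, D u v ≤ j → e m ≤ e u) ∧
      ((v = r ∨ j < lev v) → ∑ e ∈ S, w' e ≤ 0) ∧
      (v ≠ r → lev v ≤ j → ∑ e ∈ S, w' e + 2 ^ lev v ≤ 2 ^ (j + 1)) := by
  classical
  induction hn : e v using Nat.strong_induction_on generalizing v with
  | _ n ih =>
  subst hn
  by_cases hcase : v = r ∨ j < lev v
  · refine ⟨∅, v, by simp, EdgeConn.refl _ _, by simp [hD.self], ?_, by simp, ?_⟩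
    · intro u hu
      rcases hcase with rfl | hlt
      · omega
      · by_cases hv : v = r
        · subst hv; omega
        · by_contra! hlt'
          have := h.lev_le v hv u j hu hlt'
          omega
    · intro hv hle
      rcases hcase with rfl | hlt
      · exact absurd rfl hv
      · omega
  · push Not at hcase
    obtain ⟨hv, hle⟩ := hcase
    obtain ⟨S, m, hS, hconn, hm, hmin, hc0, hc1⟩ := ih _ (h.rank_lt v hv) (p v) rfl
    have hp := h.dist_le v hv
    have hp' := hD.symm (p v) v
    refine ⟨insert s(f v, f (p v)) S, m, ?_, ?_, ?_, ?_, ?_, ?_⟩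
    · rw [Finset.coe_insert]
      exact Set.insert_subset (hf v hv).1 hS
    · exact (EdgeConn.of_mem (by simp)).trans (hconn.mono (by simp))
    · have := hD.triangle m (p v) v
      omega
    · intro u hu
      refine hmin u ?_
      have := hD.triangle u v (p v)
      omega
    · rintro (h1 | h1)
      · exact absurd h1 hv
      · omega
    · intro _ _
      have hins : ∑ e ∈ insert s(f v, f (p v)) S, w' e ≤ 2 ^ lev v + ∑ e ∈ S, w' e := by
        rw [← (hf v hv).2]
        by_cases hmem : s(f v, f (p v)) ∈ S
        · rw [Finset.insert_eq_of_mem hmem]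
          linarith [hw' _ (hf v hv).1]
        · rw [Finset.sum_insert hmem]
      have h2j : (2 : ℝ) * 2 ^ lev v ≤ 2 ^ (j + 1) := by
        rw [← pow_succ']
        exact pow_le_pow_right₀ one_le_two (by omega)
      by_cases hp2 : p v = r ∨ j < lev (p v)
      · linarith [hc0 hp2]
      · push Not at hp2
        have h1 := hc1 hp2.1 hp2.2
        have h2 : (2 : ℝ) * 2 ^ lev v ≤ 2 ^ lev (p v) := by
          rw [← pow_succ']
          exact pow_le_pow_right₀ one_le_two (h.lev_lt hD hv hp2.1)
        linarith

/-- Any two points are connected in the representative tree at cost `O(2 ^ D)`. -/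
theorem exists_connect (h : IsRepresentativeTree r e D p lev) (hD : IsNatUltrametric D)
    (he : Function.Injective e) (hr : e r = 0) (hw' : ∀ e ∈ T.edgeSet, 0 ≤ w' e)
    (hf : ∀ v, v ≠ r → s(f v, f (p v)) ∈ T.edgeSet ∧ w' s(f v, f (p v)) = 2 ^ lev v)
    (u v : V) :
    ∃ S : Finset (Sym2 N), ↑S ⊆ T.edgeSet ∧ EdgeConn (↑S) (f u) (f v) ∧
      ∑ e ∈ S, w' e ≤ 4 * 2 ^ D u v := by
  classical
  have bound : ∀ x, ∃ (S : Finset (Sym2 N)) (m : V), ↑S ⊆ T.edgeSet ∧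
      EdgeConn (↑S) (f x) (f m) ∧ D m x ≤ D u v ∧ (∀ y, D y x ≤ D u v → e m ≤ e y) ∧
      ∑ e ∈ S, w' e ≤ 2 * 2 ^ D u v := by
    intro x
    obtain ⟨S, m, hS, hconn, hm, hmin, hc0, hc1⟩ := h.exists_climb hD hr hw' hf (D u v) x
    refine ⟨S, m, hS, hconn, hm, hmin, ?_⟩
    rw [← pow_succ']
    by_cases hp2 : x = r ∨ D u v < lev x
    · exact (hc0 hp2).trans (by positivity)
    · push Not at hp2
      have : (0 : ℝ) ≤ 2 ^ lev x := by positivity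
      linarith [hc1 hp2.1 hp2.2]
  obtain ⟨S₁, m₁, hS₁, hconn₁, hm₁, hmin₁, hc₁⟩ := bound u
  obtain ⟨S₂, m₂, hS₂, hconn₂, hm₂, hmin₂, hc₂⟩ := bound v
  have hm : m₁ = m₂ := by
    apply he
    have h1 := hD.triangle m₁ u v
    have h2 := hD.triangle m₂ v u
    have h3 := hD.symm u v
    exact le_antisymm (hmin₁ m₂ (by omega)) (hmin₂ m₁ (by omega))
  subst hm
  refine ⟨S₁ ∪ S₂, by simpa using ⟨hS₁, hS₂⟩,
    (hconn₁.mono (by simp)).trans (hconn₂.mono (by simp)).symm, ?_⟩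
  have h1 := Finset.sum_union_inter (s₁ := S₁) (s₂ := S₂) (f := w')
  have h2 : 0 ≤ ∑ e ∈ S₁ ∩ S₂, w' e := Finset.sum_nonneg fun e he =>
    hw' e (hS₁ (Finset.mem_inter.1 he).1)
  linarith

/-- The points of a tour are connected in the representative tree at a cost proportional to the
length of the tour, provided that `2 ^ D` is bounded by the length of each step. -/
theorem exists_connect_list (h : IsRepresentativeTree r e D p lev) (hD : IsNatUltrametric D)
    (he : Function.Injective e) (hr : e r = 0) (hw' : ∀ e ∈ T.edgeSet, 0 ≤ w' e)
    (hf : ∀ v, v ≠ r → s(f v, f (p v)) ∈ T.edgeSet ∧ w' s(f v, f (p v)) = 2 ^ lev v)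
    {d : V → V → ℝ} (hd : IsPseudometric d) {α : ℝ} (l : List V)
    (hα : ∀ u ∈ l, ∀ v ∈ l, u ≠ v → (2 : ℝ) ^ D u v ≤ α * d u v) :
    ∃ S : Finset (Sym2 N), ↑S ⊆ T.edgeSet ∧
      (∀ u ∈ l, ∀ v ∈ l, EdgeConn (↑S) (f u) (f v)) ∧
      ∑ e ∈ S, w' e ≤ 4 * α * tourLength d l := by
  classical
  induction l with
  | nil => exact ⟨∅, by simp, by simp, by simp [tourLength]⟩
  | cons a l ih =>
    cases l with
    | nil =>
      refine ⟨∅, by simp, ?_, by simp [tourLength]⟩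
      simpa using EdgeConn.refl _ _
    | cons b l =>
      obtain ⟨S, hS, hconn, hc⟩ := ih fun u hu v hv =>
        hα u (List.mem_cons_of_mem _ hu) v (List.mem_cons_of_mem _ hv)
      obtain ⟨S', hS', hconn', hc'⟩ : ∃ S : Finset (Sym2 N), ↑S ⊆ T.edgeSet ∧
          EdgeConn (↑S) (f a) (f b) ∧ ∑ e ∈ S, w' e ≤ 4 * α * d a b := by
        by_cases hab : a = b
        · subst hab
          exact ⟨∅, by simp, EdgeConn.refl _ _, by simp [hd.self]⟩
        · obtain ⟨S', hS', hconn', hc'⟩ := h.exists_connect hD he hr hw' hf a b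
          refine ⟨S', hS', hconn', hc'.trans ?_⟩
          linarith [hα a (by simp) b (by simp) hab]
      have hb : ∀ u ∈ a :: b :: l, EdgeConn (↑(S ∪ S')) (f u) (f b) := by
        intro u hu
        rcases List.mem_cons.1 hu with rfl | hu
        · exact hconn'.mono (by simp)
        · exact (hconn u hu b (by simp)).mono (by simp)
      refine ⟨S ∪ S', by simpa using ⟨hS, hS'⟩,
        fun u hu v hv => (hb u hu).trans (hb v hv).symm, ?_⟩
      have h1 := Finset.sum_union_inter (s₁ := S) (s₂ := S') (f := w')
      have h2 : 0 ≤ ∑ e ∈ S ∩ S', w' e := Finset.sum_nonneg fun e he =>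
        hw' e (hS (Finset.mem_inter.1 he).1)
      simp only [tourLength]
      linarith

end IsRepresentativeTree

/-- The graph in which every `x ≠ root` is joined to its parent. -/
def parentGraph {N : Type*} (root : N) (par : N → N) : SimpleGraph N :=
  SimpleGraph.fromRel fun x y => x ≠ root ∧ par x = y

section parentGraph

variable {N : Type*} {root : N} {par : N → N} {rank : N → ℕ}

theorem parentGraph_adj_iff (h : ∀ x, x ≠ root → rank (par x) < rank x) {x y : N} :
    (parentGraph root par).Adj x y ↔ (x ≠ root ∧ par x = y) ∨ (y ≠ root ∧ par y = x) := by
  rw [parentGraph, SimpleGraph.fromRel_adj]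
  refine ⟨fun h => h.2, fun h' => ⟨?_, h'⟩⟩
  rintro rfl
  rcases h' with h' | h' <;>
  · have := h x h'.1
    rw [h'.2] at this
    omega

theorem parentGraph_mem_edgeSet (h : ∀ x, x ≠ root → rank (par x) < rank x) {x : N}
    (hx : x ≠ root) : s(x, par x) ∈ (parentGraph root par).edgeSet :=
  (parentGraph_adj_iff h).2 (Or.inl ⟨hx, rfl⟩)

theorem exists_walk_to_root (h : ∀ x, x ≠ root → rank (par x) < rank x) :
    ∃ depth : N → ℕ, depth root = 0 ∧ (∀ x, x ≠ root → depth x = depth (par x) + 1) ∧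
      ∀ x, ∃ q : (parentGraph root par).Walk root x, q.length = depth x := by
  classical
  have key : ∀ x, ∃ n, par^[n] x = root := by
    intro x
    induction hn : rank x using Nat.strong_induction_on generalizing x with
    | _ n ih =>
    by_cases hx : x = root
    · exact ⟨0, hx⟩
    · obtain ⟨m, hm⟩ := ih _ (hn ▸ h x hx) (par x) rfl
      exact ⟨m + 1, hm⟩
  obtain ⟨depth, h0, hdepth⟩ : ∃ depth : N → ℕ, depth root = 0 ∧
      ∀ x, x ≠ root → depth x = depth (par x) + 1 :=
    ⟨fun x => Nat.find (key x), (Nat.find_eq_zero (key root)).2 rfl,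
      fun x hx => Nat.find_comp_succ (key x) (key (par x)) hx⟩
  refine ⟨depth, h0, hdepth, fun x => ?_⟩
  induction hn : rank x using Nat.strong_induction_on generalizing x with
  | _ n ih =>
  by_cases hx : x = root
  · subst hx
    exact ⟨SimpleGraph.Walk.nil, h0.symm⟩
  · obtain ⟨q, hq⟩ := ih _ (hn ▸ h x hx) (par x) rfl
    refine ⟨q.concat ((parentGraph_adj_iff h).2 (Or.inr ⟨hx, rfl⟩)), ?_⟩
    rw [SimpleGraph.Walk.length_concat, hq, hdepth x hx]

theorem parentGraph_connected (h : ∀ x, x ≠ root → rank (par x) < rank x) :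
    (parentGraph root par).Connected := by
  obtain ⟨_, -, -, hwalk⟩ := exists_walk_to_root h
  have hreach : ∀ x, (parentGraph root par).Reachable root x := fun x =>
    (hwalk x).elim fun q _ => ⟨q⟩
  exact { preconnected := fun x y => (hreach x).symm.trans (hreach y), nonempty := ⟨root⟩ }

theorem parentGraph_isTree [Finite N] (h : ∀ x, x ≠ root → rank (par x) < rank x) :
    (parentGraph root par).IsTree := by
  classical
  cases nonempty_fintype N
  rw [SimpleGraph.isTree_iff_connected_and_card]
  refine ⟨parentGraph_connected h, ?_⟩
  let φ : {x : N // x ≠ root} → (parentGraph root par).edgeSet := fun x =>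
    ⟨s(x.1, par x.1), parentGraph_mem_edgeSet h x.2⟩
  have hφ : Function.Bijective φ := by
    constructor
    · rintro ⟨x, hx⟩ ⟨y, hy⟩ hxy
      have h1 : s(x, par x) = s(y, par y) := congrArg Subtype.val hxy
      rw [Sym2.eq_iff] at h1
      rcases h1 with h1 | ⟨h1, h2⟩
      · exact Subtype.ext h1.1
      · have hx' := h x hx
        have hy' := h y hy
        rw [h2] at hx'
        rw [← h1] at hy'
        omega
    · rintro ⟨e, he⟩
      induction e using Sym2.ind with
      | _ x y =>
      rcases (parentGraph_adj_iff h).1 he with ⟨hx, hxy⟩ | ⟨hy, hyx⟩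
      · exact ⟨⟨x, hx⟩, Subtype.ext (by simp [φ, hxy])⟩
      · exact ⟨⟨y, hy⟩, Subtype.ext (by simp [φ, hyx, Sym2.eq_swap])⟩
  rw [← Nat.card_congr (Equiv.ofBijective φ hφ), Nat.card_eq_fintype_card,
    Nat.card_eq_fintype_card, Fintype.card_subtype_compl, Fintype.card_subtype_eq]
  have : 0 < Fintype.card N := Fintype.card_pos_iff.2 ⟨root⟩
  omega

/-- Moving away from the root along an edge means moving from the parent to its child. -/
theorem parentGraph_child (h : ∀ x, x ≠ root → rank (par x) < rank x) {a b : N}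
    (hab : (parentGraph root par).Adj a b)
    (hdist : (parentGraph root par).dist root b = (parentGraph root par).dist root a + 1) :
    b ≠ root ∧ par b = a := by
  obtain ⟨depth, h0, hsucc, hwalk⟩ := exists_walk_to_root h
  have hstep : ∀ x y, (parentGraph root par).Adj x y → depth y ≤ depth x + 1 := by
    intro x y hxy
    rcases (parentGraph_adj_iff h).1 hxy with ⟨hx, rfl⟩ | ⟨hy, rfl⟩
    · have := hsucc x hx; omega
    · exact (hsucc y hy).le
  have hlen : ∀ x y (q : (parentGraph root par).Walk x y), depth y ≤ depth x + q.length := by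
    intro x y q
    induction q with
    | nil => simp
    | cons hxy q ih =>
      have := hstep _ _ hxy
      rw [SimpleGraph.Walk.length_cons]
      omega
  have hd : ∀ x, (parentGraph root par).dist root x = depth x := by
    intro x
    obtain ⟨q, hq⟩ := hwalk x
    refine le_antisymm (hq ▸ SimpleGraph.dist_le q) ?_
    obtain ⟨q', hq'⟩ := (parentGraph_connected h).exists_walk_length_eq_dist root x
    have := hlen _ _ q'
    omega
  rcases (parentGraph_adj_iff h).1 hab with ⟨ha, rfl⟩ | hb
  · have := hsucc a ha
    rw [hd, hd] at hdist
    omega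
  · exact hb

/-- Edge weights given by weights of child vertices. -/
def parentWeight (rank : N → ℕ) (W : N → ℝ) : Sym2 N → ℝ :=
  Sym2.lift ⟨fun x y => (if rank x < rank y then W y else 0) + if rank y < rank x then W x else 0,
    fun _ _ => add_comm _ _⟩

theorem parentWeight_mk {W : N → ℝ} (h : ∀ x, x ≠ root → rank (par x) < rank x) {x : N}
    (hx : x ≠ root) : parentWeight rank W s(x, par x) = W x := by
  have := h x hx
  simp [parentWeight, this, this.le]

theorem exists_child_of_mem_edgeSet (h : ∀ x, x ≠ root → rank (par x) < rank x) {e : Sym2 N}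
    (he : e ∈ (parentGraph root par).edgeSet) : ∃ x, x ≠ root ∧ e = s(x, par x) := by
  induction e using Sym2.ind with
  | _ x y =>
  rcases (parentGraph_adj_iff h).1 he with ⟨hx, hxy⟩ | ⟨hy, hyx⟩
  · exact ⟨x, hx, congrArg (fun z => s(x, z)) hxy.symm⟩
  · exact ⟨y, hy, Sym2.eq_swap.trans (congrArg (fun z => s(y, z)) hyx.symm)⟩

end parentGraph

/-- Ultrametrics which are good on sets `U i` covering all pairs of vertices yield a copy tree
embedding: merge their representative trees at the root. -/
theorem exists_copyTreeEmbedding_of_cover {V : Type*} [Fintype V] (G : SimpleGraph V)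
    (w : Sym2 V → ℝ) (r : V) (hw : ∀ e ∈ G.edgeSet, 0 ≤ w e) {d : V → V → ℝ}
    (hd : IsPseudometric d) (hdw : ∀ x y, s(x, y) ∈ G.edgeSet → d x y ≤ w s(x, y))
    (hpath : ∀ x y, ∃ S : Finset (Sym2 V), ↑S ⊆ G.edgeSet ∧ EdgeConn (↑S) x y ∧
      ∑ e ∈ S, w e = d x y)
    {k : ℕ} (D : Fin k → V → V → ℕ) (U : Fin k → Finset V) {α : ℝ} (hα : 0 ≤ α)
    (hD : ∀ i, IsNatUltrametric (D i)) (hle : ∀ i u v, d u v ≤ 2 ^ D i u v)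
    (hge : ∀ i, ∀ u ∈ U i, ∀ v ∈ U i, u ≠ v → (2 : ℝ) ^ D i u v ≤ α * d u v)
    (hcover : ∀ u v, ∃ i, u ∈ U i ∧ v ∈ U i) :
    ∃ emb : CopyTreeEmbedding V (Option (Fin k × {v : V // v ≠ r})) G w r (8 * α * k),
      WellSeparated emb.tree emb.root emb.w' ∧ ∀ v : V, (emb.copies v).ncard ≤ k := by
  classical
  obtain ⟨e, he, hr⟩ : ∃ e : V → ℕ, Function.Injective e ∧ e r = 0 := by
    refine ⟨fun v => if v = r then 0 else (Fintype.equivFin V v : ℕ) + 1, ?_, by simp⟩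
    intro u v huv
    beta_reduce at huv
    split_ifs at huv with h1 h2
    · exact h1.trans h2.symm
    · exact (Fintype.equivFin V).injective (Fin.ext (Nat.succ_injective huv))
  choose p lev hrep using fun i => exists_representativeTree r e he hr (D i)
  let inc : Fin k → V → Option (Fin k × {v : V // v ≠ r}) := fun i v =>
    if h : v = r then none else some (i, ⟨v, h⟩)
  let proj : Option (Fin k × {v : V // v ≠ r}) → V := fun x => x.elim r fun y => y.2.1
  let par : Option (Fin k × {v : V // v ≠ r}) → Option (Fin k × {v : V // v ≠ r}) := fun x =>
    x.elim none fun y => inc y.1 (p y.1 y.2.1)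
  let W : Option (Fin k × {v : V // v ≠ r}) → ℝ := fun x =>
    x.elim 0 fun y => 2 ^ lev y.1 y.2.1
  let rank : Option (Fin k × {v : V // v ≠ r}) → ℕ := fun x => e (proj x)
  have hproj : ∀ i v, proj (inc i v) = v := by
    intro i v
    by_cases h : v = r <;> simp [proj, inc, h]
  have hrank : ∀ x, x ≠ none → rank (par x) < rank x := by
    rintro (_ | ⟨i, v, hv⟩) hx
    · exact absurd rfl hx
    · change e (proj (inc i (p i v))) < e v
      rw [hproj]
      exact (hrep i).rank_lt v hv
  let T := parentGraph none par
  let w' := parentWeight rank W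
  have hinc : ∀ i v, (hv : v ≠ r) → inc i v = some (i, ⟨v, hv⟩) := fun i v hv => by
    simp [inc, hv]
  have hf : ∀ i v, v ≠ r → s(inc i v, inc i (p i v)) ∈ T.edgeSet ∧
      w' s(inc i v, inc i (p i v)) = 2 ^ lev i v := by
    intro i v hv
    have hne : inc i v ≠ none := by simp [hinc i v hv]
    have hpar : inc i (p i v) = par (inc i v) := by simp [hinc i v hv, par]
    rw [hpar]
    exact ⟨parentGraph_mem_edgeSet hrank hne,
      (parentWeight_mk hrank hne).trans (by simp [hinc i v hv, W])⟩
  have hedge : ∀ e ∈ T.edgeSet, ∃ i v, v ≠ r ∧ e = s(inc i v, inc i (p i v)) := by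
    intro e he
    obtain ⟨x, hx, rfl⟩ := exists_child_of_mem_edgeSet hrank he
    obtain _ | ⟨i, v, hv⟩ := x
    · exact absurd rfl hx
    · exact ⟨i, v, hv, by simp [hinc i v hv, par]⟩
  have hw' : ∀ e ∈ T.edgeSet, 0 ≤ w' e := by
    intro e he
    obtain ⟨i, v, hv, rfl⟩ := hedge e he
    rw [(hf i v hv).2]
    positivity
  have hTG : ∀ e' : Sym2 (Option (Fin k × {v : V // v ≠ r})), ∃ S : Finset (Sym2 V),
      ↑S ⊆ G.edgeSet ∧ (e' ∈ T.edgeSet → (∀ x y, e' = s(x, y) →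
        EdgeConn (↑S) (proj x) (proj y)) ∧ ∑ e ∈ S, w e ≤ w' e') := by
    intro e'
    by_cases he' : e' ∈ T.edgeSet
    · obtain ⟨i, v, hv, rfl⟩ := hedge e' he'
      obtain ⟨S, hS, hconn, hc⟩ := hpath v (p i v)
      refine ⟨S, hS, fun _ => ⟨?_, ?_⟩⟩
      · intro x y hxy
        rw [Sym2.eq_iff] at hxy
        rcases hxy with ⟨rfl, rfl⟩ | ⟨rfl, rfl⟩
        · rwa [hproj, hproj]
        · rw [hproj, hproj]
          exact hconn.symm
      · rw [hc, (hf i v hv).2, hd.symm]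
        exact (hle i _ _).trans (pow_le_pow_right₀ one_le_two ((hrep i).dist_le v hv))
    · exact ⟨∅, by simp, fun h => absurd h he'⟩
  choose path hpathG hpathT using hTG
  have hGT : ∀ F : Finset (Sym2 V), ∃ S : Finset (Sym2 (Option (Fin k × {v : V // v ≠ r}))),
      ↑F ⊆ G.edgeSet → ↑S ⊆ T.edgeSet ∧
        (∀ u v, EdgeConn (↑F) u v → ∃ i, EdgeConn (↑S) (inc i u) (inc i v)) ∧
        ∑ e ∈ S, w' e ≤ 8 * α * k * ∑ e ∈ F, w e := by
    intro F
    by_cases hF : ↑F ⊆ G.edgeSet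
    swap
    · exact ⟨∅, fun h => absurd h hF⟩
    have hwF : ∀ e ∈ F, 0 ≤ w e := fun e he => hw e (hF he)
    let C := (SimpleGraph.fromEdgeSet (F : Set (Sym2 V))).ConnectedComponent
    have hout : ∀ (c : C) (u : V), EdgeConn (↑F) c.out u ↔
        c = SimpleGraph.connectedComponentMk _ u := by
      intro c u
      have h : SimpleGraph.connectedComponentMk _ c.out =
          SimpleGraph.connectedComponentMk _ u ↔ EdgeConn (↑F) c.out u :=
        SimpleGraph.ConnectedComponent.eq
      exact h.symm.trans ⟨(Quot.out_eq c).symm.trans, (Quot.out_eq c).trans⟩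
    choose l hl E hEF hEc hlen using fun c : C =>
      exists_tour hd F w hwF (fun x y hxy => hdw x y (hF hxy)) c.out
    have hEsum : ∑ c : C, ∑ e ∈ E c, w e ≤ ∑ e ∈ F, w e := by
      rw [← Finset.sum_biUnion]
      · exact Finset.sum_le_sum_of_subset_of_nonneg
          (Finset.biUnion_subset.2 fun c _ => hEF c) fun e he _ => hwF e he
      · intro c _ c' _ hcc'
        rw [Function.onFun, Finset.disjoint_left]
        intro e hec hec'
        induction e using Sym2.ind with
        | _ x y =>
        have h1 := (hout c x).1 (hEc c _ hec x (by simp))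
        have h2 := (hout c' x).1 (hEc c' _ hec' x (by simp))
        exact hcc' (h1.trans h2.symm)
    choose S hST hSconn hScost using fun (ci : C × Fin k) =>
      (hrep ci.2).exists_connect_list (hD ci.2) he hr hw' (hf ci.2) hd
        ((l ci.1).filter (· ∈ U ci.2))
        (fun u hu v hv => hge ci.2 u (by simpa using (List.mem_filter.1 hu).2) v
          (by simpa using (List.mem_filter.1 hv).2))
    refine ⟨Finset.univ.biUnion S, fun _ => ⟨?_, ?_, ?_⟩⟩
    · intro e he
      obtain ⟨ci, -, hci⟩ := Finset.mem_biUnion.1 (Finset.mem_coe.1 he)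
      exact hST ci hci
    · intro u v huv
      obtain ⟨i, hui, hvi⟩ := hcover u v
      have hu := (hout (SimpleGraph.connectedComponentMk _ u) u).2 rfl
      refine ⟨i, (hSconn (SimpleGraph.connectedComponentMk _ u, i) u ?_ v ?_).mono ?_⟩
      · exact List.mem_filter.2 ⟨hl _ u hu, by simpa using hui⟩
      · exact List.mem_filter.2 ⟨hl _ v (hu.trans huv), by simpa using hvi⟩
      · exact Finset.coe_subset.2 (Finset.subset_biUnion_of_mem S (Finset.mem_univ _))
    · refine (sum_biUnion_le_sum_sum _ _ _ fun ci _ e he => hw' e (hST ci he)).trans ?_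
      have h1 : ∀ ci : C × Fin k, ∑ e ∈ S ci, w' e ≤ 8 * α * ∑ e ∈ E ci.1, w e := by
        intro ci
        refine (hScost ci).trans ?_
        have h2 := (tourLength_le_of_sublist hd
          (List.filter_sublist (p := (· ∈ U ci.2)) (l := l ci.1))).1.trans (hlen ci.1)
        have h3 := mul_le_mul_of_nonneg_left h2 (mul_nonneg zero_le_four hα)
        linarith
      refine (Finset.sum_le_sum fun ci _ => h1 ci).trans ?_
      rw [Fintype.sum_prod_type]
      simp only [Finset.sum_const, Finset.card_univ, Fintype.card_fin, nsmul_eq_mul]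
      rw [← Finset.mul_sum, ← Finset.mul_sum]
      have h4 := mul_le_mul_of_nonneg_left hEsum
        (by positivity : (0 : ℝ) ≤ 8 * α * k)
      linarith
  choose mapGT hmapGT using hGT
  refine ⟨{
    tree := T
    isTree := parentGraph_isTree hrank
    w' := w'
    root := none
    copies := fun v => {x | proj x = v}
    copies_nonempty := fun v => (hcover v v).elim fun i _ => ⟨inc i v, hproj i v⟩
    copies_disjoint := fun u v huv =>
      Set.disjoint_left.2 fun x hx hx' => huv (hx.symm.trans hx')
    copies_cover := fun x => ⟨proj x, rfl⟩
    copies_root := ?_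
    mapGT := mapGT
    mapTG := fun F' => F'.biUnion path
    mapGT_sub := fun F hF => (hmapGT F hF).1
    mapTG_sub := ?_
    mapTG_mono := fun A B hAB => Finset.biUnion_subset_biUnion_of_subset_left _ hAB
    conn_GT := ?_
    conn_TG := ?_
    cost_GT := fun F hF => (hmapGT F hF).2.2
    cost_TG := ?_ }, ?_, ?_⟩
  · ext (_ | ⟨i, v, hv⟩)
    · simp [proj]
    · simpa [proj] using hv
  · intro F' _ e he
    obtain ⟨e', -, he'⟩ := Finset.mem_biUnion.1 (Finset.mem_coe.1 he)
    exact hpathG e' he'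
  · intro F hF u v huv
    obtain ⟨i, hi⟩ := (hmapGT F hF).2.1 u v huv
    exact ⟨inc i u, hproj i u, inc i v, hproj i v, hi⟩
  · rintro F' hF' u v u' v' rfl rfl huv
    refine huv.map fun a b hab => ?_
    refine ((hpathT _ (hF' hab)).1 a b rfl).mono ?_
    exact Finset.coe_subset.2 (Finset.subset_biUnion_of_mem path (Finset.mem_coe.1 hab))
  · intro F' hF'
    exact (sum_biUnion_le_sum_sum _ _ _ fun e' _ e he => hw e (hpathG e' he)).trans
      (Finset.sum_le_sum fun e' he' => (hpathT e' (hF' he')).2)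
  · intro a b c hab hbc hdab hdbc
    obtain ⟨hb, rfl⟩ := parentGraph_child hrank hab hdab
    obtain ⟨hc, rfl⟩ := parentGraph_child hrank hbc hdbc
    obtain _ | ⟨i, v, hv⟩ := c
    · exact absurd rfl hc
    have hpv : p i v ≠ r := by
      intro h
      exact hb (by simp [par, inc, h])
    have h1 : par (some (i, ⟨v, hv⟩)) = inc i (p i v) := rfl
    have h2 : par (inc i (p i v)) = inc i (p i (p i v)) := by simp [hinc i _ hpv, par]
    change w' _ ≤ w' _ / 2
    rw [h1, h2, ← hinc i v hv, Sym2.eq_swap, (hf i v hv).2, Sym2.eq_swap, (hf i _ hpv).2,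
      le_div_iff₀ two_pos, ← pow_succ]
    exact pow_le_pow_right₀ one_le_two ((hrep i).lev_lt (hD i) hv hpv)
  · intro v
    have hsub : {x | proj x = v} ⊆ (fun i => inc i v) '' Set.univ := by
      rintro (_ | ⟨i, u, hu⟩) rfl
      · obtain ⟨i, -⟩ := hcover r r
        exact ⟨i, trivial, by simp [inc, proj]⟩
      · exact ⟨i, trivial, hinc i u hu⟩
    refine (Set.ncard_le_ncard hsub (Set.toFinite _)).trans ?_
    refine (Set.ncard_image_le Set.finite_univ).trans ?_
    simp [Set.ncard_univ]

/-- There is a universal constant `C` such that every weighted graph on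
`n ≥ 2` vertices with edge weights at least `1`, with any root `r`, admits a well-separated
`(C·log²n)`-approximate copy tree embedding with copy number at most `C·log n`. -/
theorem exists_copyTreeEmbedding_logSq_approx_log_copies :
    ∃ C : ℝ, 0 < C ∧
      ∀ (V : Type) [Fintype V], ∀ (G : SimpleGraph V) (w : Sym2 V → ℝ) (r : V),
        2 ≤ Fintype.card V → G.Connected → (∀ e ∈ G.edgeSet, 1 ≤ w e) →
        ∃ (V' : Type) (_ : Finite V')
          (emb : CopyTreeEmbedding V V' G w r
            (C * Real.log (Fintype.card V : ℝ) ^ 2)),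
          WellSeparated emb.tree emb.root emb.w' ∧
          ∀ v : V, ((emb.copies v).ncard : ℝ) ≤ C * Real.log (Fintype.card V : ℝ) := by
  classical
  refine ⟨5376, by norm_num, fun V _ G w r hn hG hw => ?_⟩
  set n : ℝ := (Fintype.card V : ℝ) with hndef
  have hn2 : (2 : ℝ) ≤ n := by rw [hndef]; exact_mod_cast hn
  have hlog2 : (0.69 : ℝ) < Real.log 2 := by linarith [Real.log_two_gt_d9]
  have hlogn : Real.log 2 ≤ Real.log n := Real.log_le_log two_pos hn2
  have hlog2' : Real.log 2 < 0.7 := by linarith [Real.log_two_lt_d9]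
  have hlogm : Real.log (2 * n ^ 2) = Real.log 2 + 2 * Real.log n := by
    rw [Real.log_mul two_ne_zero (by positivity), Real.log_pow]
    norm_num
  obtain ⟨d, hd, hsep, hdw, hpath⟩ := exists_graph_metric G w hG hw
  set L : ℕ := ⌈4 * Real.log (2 * n ^ 2)⌉₊ with hLdef
  have hL4 : 4 * Real.log (2 * n ^ 2) ≤ L := Nat.le_ceil _
  have hL : 0 < L := Nat.ceil_pos.2 (by rw [hlogm]; linarith)
  have hL14 : (L : ℝ) ≤ 14 * Real.log n := by
    have := Nat.ceil_lt_add_one (a := 4 * Real.log (2 * n ^ 2)) (by rw [hlogm]; linarith)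
    rw [← hLdef, hlogm] at this
    linarith
  set k : ℕ := Nat.log 2 (Fintype.card V ^ 2) + 1 with hkdef
  have hk6 : (k : ℝ) ≤ 6 * Real.log n := by
    have h1 : (2 : ℝ) ^ Nat.log 2 (Fintype.card V ^ 2) ≤ n ^ 2 := by
      rw [hndef]
      exact_mod_cast Nat.pow_log_le_self 2 (by positivity : Fintype.card V ^ 2 ≠ 0)
    have h2 := Real.log_le_log (by positivity) h1
    rw [Real.log_pow, Real.log_pow] at h2
    have h3 : (0 : ℝ) ≤ (Nat.log 2 (Fintype.card V ^ 2) : ℝ) := Nat.cast_nonneg _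
    rw [hkdef]
    push_cast at h2 ⊢
    nlinarith
  obtain ⟨f, hf⟩ := exists_cover_of_half_cover
    (α := {DU : (V → V → ℕ) × Finset V // IsNatUltrametric DU.1 ∧ (∀ u v, d u v ≤ 2 ^ DU.1 u v) ∧
      ∀ u ∈ DU.2, ∀ v ∈ DU.2, u ≠ v → (2 : ℝ) ^ DU.1 u v ≤ 8 * L * d u v})
    (β := V × V) (fun DU q => q.1 ∈ DU.1.2 ∧ q.2 ∈ DU.1.2)
    (fun P => by
      obtain ⟨D, U, h1, h2, h3, h4⟩ :=
        exists_ultrametric_half_pairs hd hsep L hL (by omega) hL4 P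
      exact ⟨⟨(D, U), h1, h2, h3⟩, h4⟩)
    k Finset.univ (by
      rw [Finset.card_univ, Fintype.card_prod, ← sq]
      exact Nat.lt_pow_succ_log_self one_lt_two _)
  obtain ⟨emb, hsepd, hcopies⟩ := exists_copyTreeEmbedding_of_cover G w r
    (fun e he => zero_le_one.trans (hw e he)) hd hdw hpath (k := k) (fun i => (f i).1.1)
    (fun i => (f i).1.2) (α := 8 * L) (by positivity) (fun i => (f i).2.1) (fun i => (f i).2.2.1)
    (fun i => (f i).2.2.2) fun u v => by
      obtain ⟨i, hi, h⟩ := hf (u, v) (Finset.mem_univ _)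
      exact ⟨⟨i, hi⟩, h⟩
  have hconst : 8 * (8 * (L : ℝ)) * k ≤ 5376 * Real.log n ^ 2 := by
    have := mul_le_mul hL14 hk6 (Nat.cast_nonneg _) (by linarith)
    nlinarith
  refine ⟨_, inferInstance, { emb with
    cost_GT := fun F hF => (emb.cost_GT F hF).trans (mul_le_mul_of_nonneg_right hconst
      (Finset.sum_nonneg fun e he => zero_le_one.trans (hw e (hF he)))) }, hsepd, fun v => ?_⟩
  calc ((emb.copies v).ncard : ℝ) ≤ k := by exact_mod_cast hcopies v
    _ ≤ 5376 * Real.log n := by linarith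
end

section
/- Let G=(V,E,w) be a weighted graph with root r ∈ V and let (T,φ,π_{G→T},π_{T→G}) be an α-approximate copy tree embedding of (G,r) with tree root r'. If there exists a β-competitive online group Steiner tree algorithm on the tree T with root r', then there exists an (α·β)-competitive online group Steiner tree algorithm on G with root r. -/
/-- A feasible group Steiner tree solution: an edge set of `G` connecting at least one
vertex of each group to the root `r`. -/
def GSTFeasible {V : Type*} (G : SimpleGraph V) (r : V) (gs : List (Set V))
    (H : Finset (Sym2 V)) : Prop :=
  ↑H ⊆ G.edgeSet ∧ ∀ g ∈ gs, SetConn (↑H) g {r}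

/-- A group Steiner tree request sequence is valid when all its groups are nonempty
(so that the instance is satisfiable). -/
def GSTValid {V : Type*} (gs : List (Set V)) : Prop := ∀ g ∈ gs, g.Nonempty

/-- `A` is a `β`-competitive online group Steiner tree algorithm on the weighted graph
`(G, w)` with root `r`: it maps each request sequence to an edge set, is monotone under
one-step extensions, always maintains a feasible solution, and its cost is at most `β`
times the cost of any (hence the optimal) offline feasible solution. -/
def IsOnlineGST {V : Type*} (G : SimpleGraph V) (w : Sym2 V → ℝ) (r : V) (β : ℝ)
    (A : List (Set V) → Finset (Sym2 V)) : Prop :=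
  (∀ (gs : List (Set V)) (g : Set V), GSTValid (gs ++ [g]) → A gs ⊆ A (gs ++ [g])) ∧
  (∀ gs : List (Set V), GSTValid gs → GSTFeasible G r gs (A gs)) ∧
  (∀ gs : List (Set V), GSTValid gs → ∀ F : Finset (Sym2 V), GSTFeasible G r gs F →
    ∑ e ∈ A gs, w e ≤ β * ∑ e ∈ F, w e)

theorem SetConn.of_mem_right_singleton {V : Type*} {F : Set (Sym2 V)} {U : Set V} {r : V}
    (h : SetConn F U {r}) : ∃ u ∈ U, EdgeConn F u r := by
  obtain ⟨u, hu, x, rfl, h⟩ := h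
  exact ⟨u, hu, h⟩

/-- The edges of a walk connect its endpoints. -/
theorem EdgeConn.of_walk {V : Type*} {G : SimpleGraph V} {u v : V} (p : G.Walk u v)
    {F : Set (Sym2 V)} (hF : ∀ e ∈ p.edges, e ∈ F) : EdgeConn F u v :=
  (p.transfer (SimpleGraph.fromEdgeSet F) fun e he => by
    rw [SimpleGraph.edgeSet_fromEdgeSet]
    exact ⟨hF e he, G.not_isDiag_of_mem_edgeSet (p.edges_subset_edgeSet he)⟩).reachable

theorem EdgeConn.eq_of_empty {V : Type*} {u v : V} (h : EdgeConn (∅ : Set (Sym2 V)) u v) :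
    u = v := by
  simpa [EdgeConn] using h

theorem sum_weight_nonneg {V : Type*} {G : SimpleGraph V} {w : Sym2 V → ℝ}
    (hw : ∀ e ∈ G.edgeSet, 1 ≤ w e) {F : Finset (Sym2 V)} (hF : ↑F ⊆ G.edgeSet) :
    0 ≤ ∑ e ∈ F, w e :=
  Finset.sum_nonneg fun e he => zero_le_one.trans (hw e (hF he))

theorem eq_empty_of_sum_weight_nonpos {V : Type*} {G : SimpleGraph V} {w : Sym2 V → ℝ}
    (hw : ∀ e ∈ G.edgeSet, 1 ≤ w e) {F : Finset (Sym2 V)} (hF : ↑F ⊆ G.edgeSet)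
    (h : ∑ e ∈ F, w e ≤ 0) : F = ∅ := by
  by_contra hne
  exact h.not_gt <| Finset.sum_pos (fun e he => zero_lt_one.trans_le (hw e (hF he)))
    (Finset.nonempty_iff_ne_empty.mpr hne)

namespace CopyTreeEmbedding

variable {V V' : Type*} {G : SimpleGraph V} {w : Sym2 V → ℝ} {r : V} {α : ℝ}

/-- The group of all copies of the vertices of a group. -/
def liftGroup (emb : CopyTreeEmbedding V V' G w r α) (g : Set V) : Set V' :=
  ⋃ v ∈ g, emb.copies v

theorem gstValid_map_liftGroup (emb : CopyTreeEmbedding V V' G w r α) {gs : List (Set V)}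
    (h : GSTValid gs) : GSTValid (gs.map emb.liftGroup) := by
  intro g' hg'
  obtain ⟨g, hg, rfl⟩ := List.mem_map.mp hg'
  obtain ⟨v, hv⟩ := h g hg
  obtain ⟨v', hv'⟩ := emb.copies_nonempty v
  exact ⟨v', Set.mem_biUnion hv hv'⟩

theorem gstFeasible_mapGT (emb : CopyTreeEmbedding V V' G w r α) {gs : List (Set V)}
    {F : Finset (Sym2 V)} (h : GSTFeasible G r gs F) :
    GSTFeasible emb.tree emb.root (gs.map emb.liftGroup) (emb.mapGT F) := by
  refine ⟨emb.mapGT_sub F h.1, fun g' hg' => ?_⟩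
  obtain ⟨g, hg, rfl⟩ := List.mem_map.mp hg'
  obtain ⟨u, hu, hur⟩ := (h.2 g hg).of_mem_right_singleton
  obtain ⟨u', hu', x, hx, hc⟩ := emb.conn_GT F h.1 u r hur
  rw [emb.copies_root] at hx
  exact ⟨u', Set.mem_biUnion hu hu', x, hx, hc⟩

theorem gstFeasible_mapTG (emb : CopyTreeEmbedding V V' G w r α) {gs : List (Set V)}
    {F' : Finset (Sym2 V')}
    (h : GSTFeasible emb.tree emb.root (gs.map emb.liftGroup) F') :
    GSTFeasible G r gs (emb.mapTG F') := by
  refine ⟨emb.mapTG_sub F' h.1, fun g hg => ?_⟩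
  obtain ⟨u', hu', hc⟩ := (h.2 _ (List.mem_map_of_mem hg)).of_mem_right_singleton
  obtain ⟨u, hu, huu'⟩ := Set.mem_iUnion₂.mp hu'
  exact ⟨u, hu, r, rfl, emb.conn_TG F' h.1 u r u' emb.root huu'
    (emb.copies_root ▸ Set.mem_singleton _) hc⟩

theorem sum_weight_tree_nonneg (emb : CopyTreeEmbedding V V' G w r α)
    (hw : ∀ e ∈ G.edgeSet, 1 ≤ w e) {F' : Finset (Sym2 V')} (hF' : ↑F' ⊆ emb.tree.edgeSet) :
    0 ≤ ∑ e ∈ F', emb.w' e :=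
  (sum_weight_nonneg hw (emb.mapTG_sub F' hF')).trans (emb.cost_TG F' hF')

/-- If every edge set of the tree has nonpositive weight, then the graph has no edges. -/
theorem edgeSet_eq_empty (emb : CopyTreeEmbedding V V' G w r α)
    (hw : ∀ e ∈ G.edgeSet, 1 ≤ w e)
    (h : ∀ F' : Finset (Sym2 V'), ↑F' ⊆ emb.tree.edgeSet → ∑ e ∈ F', emb.w' e ≤ 0) :
    G.edgeSet = ∅ := by
  classical
  refine Set.eq_empty_iff_forall_notMem.mpr fun e => ?_
  induction e with | _ a b
  intro hab
  obtain ⟨a', ha'⟩ := emb.copies_nonempty a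
  obtain ⟨b', hb'⟩ := emb.copies_nonempty b
  obtain ⟨p⟩ := emb.isTree.connected.preconnected a' b'
  have hp : (↑p.edges.toFinset : Set (Sym2 V')) ⊆ emb.tree.edgeSet := fun e he =>
    p.edges_subset_edgeSet (by simpa using he)
  have hc := emb.conn_TG _ hp a b a' b' ha' hb' (.of_walk p fun e he => by simpa using he)
  rw [eq_empty_of_sum_weight_nonpos hw (emb.mapTG_sub _ hp)
    ((emb.cost_TG _ hp).trans (h _ hp)), Finset.coe_empty] at hc
  exact G.ne_of_adj hab hc.eq_of_empty

end CopyTreeEmbedding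

/-- A negative competitive ratio forces every edge set to have nonpositive weight. -/
theorem IsOnlineGST.sum_weight_nonpos {V : Type*} {G : SimpleGraph V} {w : Sym2 V → ℝ} {r : V}
    {β : ℝ} {A : List (Set V) → Finset (Sym2 V)} (hA : IsOnlineGST G w r β A) (hβ : β < 0)
    (hw : ∀ F : Finset (Sym2 V), ↑F ⊆ G.edgeSet → 0 ≤ ∑ e ∈ F, w e)
    {F : Finset (Sym2 V)} (hF : ↑F ⊆ G.edgeSet) : ∑ e ∈ F, w e ≤ 0 := by
  have hv : GSTValid ([] : List (Set V)) := by simp [GSTValid]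
  have hle := hA.2.2 [] hv F ⟨hF, by simp⟩
  have h0 := hw _ (hA.2.1 [] hv).1
  by_contra! hpos
  exact (h0.trans hle).not_gt (mul_neg_of_neg_of_pos hβ hpos)

/-- If `(T, φ, π_{G→T}, π_{T→G})` is an `α`-approximate copy tree
embedding of the weighted graph `(G, r)` and there is a `β`-competitive online group
Steiner tree algorithm on the tree `T` with root `r'`, then there is an `(α·β)`-competitive
online group Steiner tree algorithm on `G` with root `r`. -/
theorem onlineGST_of_copyTreeEmbedding {V V' : Type} (G : SimpleGraph V)
    (w : Sym2 V → ℝ) (r : V) (hG : G.Connected) (hw : ∀ e ∈ G.edgeSet, 1 ≤ w e)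
    (α β : ℝ) (emb : CopyTreeEmbedding V V' G w r α)
    (hT : ∃ A' : List (Set V') → Finset (Sym2 V'),
      IsOnlineGST emb.tree emb.w' emb.root β A') :
    ∃ A : List (Set V) → Finset (Sym2 V), IsOnlineGST G w r (α * β) A := by
  obtain ⟨A', hA'⟩ := hT
  refine ⟨fun gs => emb.mapTG (A' (gs.map emb.liftGroup)), fun gs g hgs => ?_, fun gs hgs => ?_,
    fun gs hgs F hF => ?_⟩
  · have hv := emb.gstValid_map_liftGroup hgs
    beta_reduce
    rw [List.map_append, List.map_singleton] at hv ⊢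
    exact emb.mapTG_mono _ _ (hA'.1 _ _ hv)
  · exact emb.gstFeasible_mapTG (hA'.2.1 _ (emb.gstValid_map_liftGroup hgs))
  · have hv := emb.gstValid_map_liftGroup hgs
    have hsub := (hA'.2.1 _ hv).1
    rcases le_or_gt 0 β with hβ | hβ
    · calc
        _ ≤ ∑ e ∈ A' (gs.map emb.liftGroup), emb.w' e := emb.cost_TG _ hsub
        _ ≤ β * ∑ e ∈ emb.mapGT F, emb.w' e := hA'.2.2 _ hv _ (emb.gstFeasible_mapGT hF)
        _ ≤ β * (α * ∑ e ∈ F, w e) := mul_le_mul_of_nonneg_left (emb.cost_GT F hF.1) hβ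
        _ = α * β * ∑ e ∈ F, w e := by ring
    · have hE := emb.edgeSet_eq_empty hw fun _ =>
        hA'.sum_weight_nonpos hβ fun _ => emb.sum_weight_tree_nonneg hw
      have hempty : ∀ H : Finset (Sym2 V), ↑H ⊆ G.edgeSet → H = ∅ := fun H hH => by
        rwa [hE, Set.subset_empty_iff, Finset.coe_eq_empty] at hH
      simp [hempty _ hF.1, hempty _ (emb.mapTG_sub _ hsub)]
end
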